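/- If a clause C is semantically blocked in a formula F, then C is super-blocked in F. -/

import Mathlib

abbrev Var := ℕ
abbrev Lit := Var × Bool
abbrev Clause := Finset Lit
abbrev Formula := Set Clause

def Lit.compl (l : Lit) : Lit := (l.1, !l.2)

def Clause.isTaut (C : Clause) : Prop := ∃ l ∈ C, Lit.compl l ∈ C

abbrev Assign := Var → Bool

def litSat (τ : Assign) (l : Lit) : Prop := τ l.1 = l.2
def clauseSat (τ : Assign) (C : Clause) : Prop := ∃ l ∈ C, litSat τ l
def formulaSat (τ : Assign) (F : Formula) : Prop := ∀ C ∈ F, clauseSat τ C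
def satisfiable (F : Formula) : Prop := ∃ τ : Assign, formulaSat τ F
def satEquiv (F G : Formula) : Prop := satisfiable F ↔ satisfiable G
def redundant (F : Formula) (C : Clause) : Prop := satEquiv (F \ {C}) (F ∪ {C})

def env (F : Formula) (C : Clause) : Formula := {D ∈ F | ∃ l ∈ D, Lit.compl l ∈ C}
def clauseVars (C : Clause) : Set Var := {v | ∃ l ∈ C, l.1 = v}
def formulaVars (F : Formula) : Set Var := {v | ∃ D ∈ F, ∃ l ∈ D, l.1 = v}
def extVars (F : Formula) (C : Clause) : Set Var := formulaVars (env F C) \ clauseVars C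

def semBlocked (F : Formula) (C : Clause) : Prop :=
  ∀ τ : Assign, formulaSat τ (env F C) →
    ∃ τ' : Assign, formulaSat τ' (env F C ∪ {C}) ∧ ∀ v : Var, v ∉ clauseVars C → τ v = τ' v

def blocksLit (F : Formula) (C : Clause) (l : Lit) : Prop :=
  l ∈ C ∧ ∀ D ∈ F, Lit.compl l ∈ D → Clause.isTaut (C ∪ D.erase (Lit.compl l))
def litBlocked (F : Formula) (C : Clause) : Prop := ∃ l : Lit, blocksLit F C l

def complSet (L : Finset Lit) : Finset Lit := L.image Lit.compl
def blocksSet (F : Formula) (C : Clause) (L : Finset Lit) : Prop :=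
  L.Nonempty ∧ L ⊆ C ∧
    ∀ D ∈ F, (D ∩ complSet L).Nonempty → Clause.isTaut ((C \ L) ∪ complSet L ∪ D)
def setBlocked (F : Formula) (C : Clause) : Prop := ∃ L : Finset Lit, blocksSet F C L

abbrev PAssign := Var → Option Bool
def pdom (σ : PAssign) : Set Var := {v | σ v ≠ none}
def plitSat (σ : PAssign) (l : Lit) : Prop := σ l.1 = some l.2
def pclauseSat (σ : PAssign) (C : Clause) : Prop := ∃ l ∈ C, plitSat σ l
def pformulaSat (σ : PAssign) (F : Formula) : Prop := ∀ C ∈ F, pclauseSat σ C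
def restrictF (F : Formula) (σ : PAssign) : Formula := {D ∈ F | ¬ pclauseSat σ D}
def punion (σ₁ σ₂ : PAssign) : PAssign := fun v => (σ₁ v).orElse (fun _ => σ₂ v)

def superBlocked (F : Formula) (C : Clause) : Prop :=
  ∀ σ : PAssign, pdom σ = extVars F C → setBlocked (restrictF F σ) C

def litClauses (F : Formula) (l : Lit) : Formula := {D ∈ F | l ∈ D}
def resolvents (F : Formula) (x : Var) : Formula :=
  {R | ∃ C ∈ litClauses F (x, true), ∃ D ∈ litClauses F (x, false),
    R = C.erase (x, true) ∪ D.erase (x, false) ∧ ¬ Clause.isTaut R}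
def elimVar (F : Formula) (x : Var) : Formula :=
  (F \ (litClauses F (x, true) ∪ litClauses F (x, false))) ∪ resolvents F x

def asymLit (F : Formula) (C : Clause) (l : Lit) : Prop :=
  ∃ D : Clause, D ⊆ C ∧ insert (Lit.compl l) D ∈ F \ {C}
def asymTaut (F : Formula) (C : Clause) : Prop :=
  ∃ ls : List Lit, Clause.isTaut (C ∪ ls.toFinset) ∧
    ∀ i : Fin ls.length, asymLit F (C ∪ (ls.take i.val).toFinset) (ls.get i)
def ratPair (F : Formula) (C : Clause) : Prop :=
  asymTaut F C ∨
    ∃ l ∈ C, ∀ D ∈ F, Lit.compl l ∈ D → asymTaut F (C ∪ D.erase (Lit.compl l))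

theorem Lit.compl_compl (l : Lit) : Lit.compl (Lit.compl l) = l := by
  simp [Lit.compl]

/-- A tautology is set-blocked, with itself as the blocking set. -/
theorem setBlocked_of_isTaut (F : Formula) {C : Clause} (hC : C.isTaut) : setBlocked F C := by
  obtain ⟨l, hl, hl'⟩ := hC
  refine ⟨C, ⟨l, hl⟩, subset_rfl, fun D _ _ => ⟨l, ?_, ?_⟩⟩
  · have : l ∈ complSet C := Finset.mem_image.2 ⟨_, hl', Lit.compl_compl l⟩
    simp [this]
  · have : Lit.compl l ∈ complSet C := Finset.mem_image_of_mem _ hl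
    simp [this]

theorem formulaSat_env_of_not_litSat {F : Formula} {C : Clause} {τ : Assign}
    (hτ : ∀ l ∈ C, ¬ litSat τ l) : formulaSat τ (env F C) := by
  rintro D ⟨-, l, hlD, hlC⟩
  exact ⟨l, hlD, by simpa [litSat, Lit.compl] using hτ _ hlC⟩

/-- A clause that is not a tautology is falsified by some extension of any partial assignment
whose domain avoids its variables. -/
theorem exists_extension_not_litSat {C : Clause} (hC : ¬ C.isTaut) {σ : PAssign}
    (hσ : Disjoint (pdom σ) (clauseVars C)) :
    ∃ τ : Assign, (∀ v b, σ v = some b → τ v = b) ∧ ∀ l ∈ C, ¬ litSat τ l := by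
  classical
  refine ⟨fun v => (σ v).getD (decide ((v, true) ∉ C)), fun v b h => by simp [h], ?_⟩
  rintro ⟨v, b⟩ hl
  have hv : σ v = none := by
    by_contra h
    exact Set.disjoint_left.1 hσ h ⟨_, hl, rfl⟩
  cases b
  · have : (v, true) ∉ C := fun h => hC ⟨_, h, hl⟩
    simp [litSat, hv, this]
  · simp [litSat, hv, hl]

theorem semBlocked_superBlocked (F : Formula) (C : Clause) (h : semBlocked F C) :
    superBlocked F C := by
  classical
  intro σ hσ
  by_cases hC : C.isTaut
  · exact setBlocked_of_isTaut _ hC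
  obtain ⟨τ, hστ, hτC⟩ := exists_extension_not_litSat hC (σ := σ)
    (hσ ▸ Set.disjoint_sdiff_left)
  obtain ⟨τ', hτ', hagree⟩ := h τ (formulaSat_env_of_not_litSat hτC)
  obtain ⟨l, hlC, hl⟩ := hτ' C (Or.inr rfl)
  refine ⟨C.filter (litSat τ'), ⟨l, Finset.mem_filter.2 ⟨hlC, hl⟩⟩, Finset.filter_subset _ _, ?_⟩
  rintro D ⟨hDF, hDσ⟩ ⟨k, hk⟩
  obtain ⟨hkD, hkL⟩ := Finset.mem_inter.1 hk
  obtain ⟨k, hkC, rfl⟩ := Finset.mem_image.1 hkL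
  have hD : D ∈ env F C :=
    ⟨hDF, _, hkD, by simpa [Lit.compl_compl] using (Finset.mem_filter.1 hkC).1⟩
  obtain ⟨m, hmD, hm⟩ := hτ' D (Or.inl hD)
  have hmv : m.1 ∈ clauseVars C := by
    by_contra hmv
    have hdom : m.1 ∈ pdom σ := hσ ▸ ⟨⟨D, hD, m, hmD, rfl⟩, hmv⟩
    obtain ⟨b, hb⟩ := Option.ne_none_iff_exists'.1 hdom
    refine hDσ ⟨m, hmD, ?_⟩
    rw [plitSat, hb, ← hστ _ _ hb, hagree _ hmv, hm]
  refine ⟨m, Finset.mem_union_right _ hmD, Finset.mem_union_left _ ?_⟩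
  obtain ⟨n, hnC, hn⟩ := hmv
  by_cases hnm : n = m
  · subst hnm
    exact Finset.mem_union_right _
      (Finset.mem_image_of_mem _ (Finset.mem_filter.2 ⟨hnC, hm⟩))
  · have hnm' : n = Lit.compl m := by
      refine Prod.ext hn (Bool.eq_not_of_ne fun h => hnm (Prod.ext hn h))
    subst hnm'
    refine Finset.mem_union_left _ (Finset.mem_sdiff.2 ⟨hnC, fun h => ?_⟩)
    have := (Finset.mem_filter.1 h).2
    simp_all [litSat, Lit.compl]
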